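/- arXiv:1603.03560 — 8 statements merged into one kernel-verified Lean document; each statement's English description precedes it below -/
import Mathlib

section
/- Gärtner (discrete Hopf–Cole) drift identity: let γ ∈ ℝ, p := e^{2γ}/(1 + e^{2γ}), let k ∈ ℤ and S : ℤ → ℤ satisfy |S(k+1) - S(k)| = 1 and |S(k) - S(k-1)| = 1, and set ξ(j) := e^{-γ S(j)}. Then p·1[ΔS(k) = 2]·(e^{-2γ} - 1)·ξ(k) + (1-p)·1[ΔS(k) = -2]·(e^{2γ} - 1)·ξ(k) = (e^{γ} + e^{-γ})^{-1}·Δξ(k) - ((e^{γ} + e^{-γ} - 2)/(e^{γ} + e^{-γ}))·ξ(k), where Δf(k) := f(k+1) - 2f(k) + f(k-1). -/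
/-- Gärtner's (discrete Hopf–Cole) drift identity: with `p = e^{2γ}/(1+e^{2γ})` and
`ξ(j) = e^{-γ S(j)}`, for any nearest-neighbour path `S` around the site `k`,
`p·1[ΔS(k)=2]·(e^{-2γ}-1)·ξ(k) + (1-p)·1[ΔS(k)=-2]·(e^{2γ}-1)·ξ(k)
  = (e^γ+e^{-γ})⁻¹·Δξ(k) - ((e^γ+e^{-γ}-2)/(e^γ+e^{-γ}))·ξ(k)`. -/
theorem gartner_drift_identity (γ : ℝ) (p : ℝ) (hp : p = Real.exp (2 * γ) / (1 + Real.exp (2 * γ)))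
    (k : ℤ) (S : ℤ → ℤ) (h1 : |S (k + 1) - S k| = 1) (h2 : |S k - S (k - 1)| = 1)
    (ξ : ℤ → ℝ) (hξ : ∀ j : ℤ, ξ j = Real.exp (-γ * (S j : ℝ))) :
    p * (if S (k + 1) - 2 * S k + S (k - 1) = 2 then (1 : ℝ) else 0) *
        (Real.exp (-(2 * γ)) - 1) * ξ k
      + (1 - p) * (if S (k + 1) - 2 * S k + S (k - 1) = -2 then (1 : ℝ) else 0) *
        (Real.exp (2 * γ) - 1) * ξ k
    = (Real.exp γ + Real.exp (-γ))⁻¹ * (ξ (k + 1) - 2 * ξ k + ξ (k - 1))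
      - ((Real.exp γ + Real.exp (-γ) - 2) / (Real.exp γ + Real.exp (-γ))) * ξ k := by
  have hup (m : ℤ) (h : m = S k + 1) :
      Real.exp (-γ * (m : ℝ)) = (Real.exp γ)⁻¹ * Real.exp (-γ * (S k : ℝ)) := by
    rw [h, ← Real.exp_neg, ← Real.exp_add]
    push_cast
    ring_nf
  have hdown (m : ℤ) (h : m = S k - 1) :
      Real.exp (-γ * (m : ℝ)) = Real.exp γ * Real.exp (-γ * (S k : ℝ)) := by
    rw [h, ← Real.exp_add]
    push_cast
    ring_nf
  have hsq : Real.exp (2 * γ) = Real.exp γ ^ 2 := by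
    rw [← Real.exp_nat_mul]
    norm_num
  rw [hp, hξ, hξ, hξ, Real.exp_neg (2 * γ), Real.exp_neg γ, hsq]
  rcases (abs_eq zero_le_one).1 h1 with h1 | h1 <;>
    rcases (abs_eq zero_le_one).1 h2 with h2 | h2
  · rw [if_neg (by omega), if_neg (by omega), hup (S (k + 1)) (by omega),
      hdown (S (k - 1)) (by omega)]
    field_simp
    ring
  · rw [if_pos (by omega), if_neg (by omega), hup (S (k + 1)) (by omega),
      hup (S (k - 1)) (by omega)]
    field_simp
    ring
  · rw [if_neg (by omega), if_pos (by omega), hdown (S (k + 1)) (by omega),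
      hdown (S (k - 1)) (by omega)]
    field_simp
    ring
  · rw [if_neg (by omega), if_neg (by omega), hdown (S (k + 1)) (by omega),
      hup (S (k - 1)) (by omega)]
    field_simp
    ring
end

section
/- Gärtner (discrete Hopf–Cole) bracket identity: let γ ∈ ℝ, p := e^{2γ}/(1 + e^{2γ}), let k ∈ ℤ and S : ℤ → ℤ satisfy |S(k+1) - S(k)| = 1 and |S(k) - S(k-1)| = 1, and set ξ(j) := e^{-γ S(j)}. Then p·1[ΔS(k) = 2]·(e^{-2γ} - 1)²·ξ(k)² + (1-p)·1[ΔS(k) = -2]·(e^{2γ} - 1)²·ξ(k)² = ((e^{γ} + e^{-γ} - 2)/(e^{γ} + e^{-γ}))·(ξ(k)·Δξ(k) + 2ξ(k)²) - (ξ(k+1) - ξ(k))·(ξ(k) - ξ(k-1)), where Δf(k) := f(k+1) - 2f(k) + f(k-1). -/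
/-- Gärtner's (discrete Hopf–Cole) bracket identity: with `p = e^{2γ}/(1+e^{2γ})` and
`ξ(j) = e^{-γ S(j)}`, for any nearest-neighbour path `S` around the site `k`,
`p·1[ΔS(k)=2]·(e^{-2γ}-1)²·ξ(k)² + (1-p)·1[ΔS(k)=-2]·(e^{2γ}-1)²·ξ(k)²
  = ((e^γ+e^{-γ}-2)/(e^γ+e^{-γ}))·(ξ(k)·Δξ(k) + 2ξ(k)²)
    - (ξ(k+1)-ξ(k))·(ξ(k)-ξ(k-1))`. -/
theorem gartner_bracket_identity (γ : ℝ) (p : ℝ)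
    (hp : p = Real.exp (2 * γ) / (1 + Real.exp (2 * γ)))
    (k : ℤ) (S : ℤ → ℤ) (h1 : |S (k + 1) - S k| = 1) (h2 : |S k - S (k - 1)| = 1)
    (ξ : ℤ → ℝ) (hξ : ∀ j : ℤ, ξ j = Real.exp (-γ * (S j : ℝ))) :
    p * (if S (k + 1) - 2 * S k + S (k - 1) = 2 then (1 : ℝ) else 0) *
        (Real.exp (-(2 * γ)) - 1) ^ 2 * ξ k ^ 2
      + (1 - p) * (if S (k + 1) - 2 * S k + S (k - 1) = -2 then (1 : ℝ) else 0) *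
        (Real.exp (2 * γ) - 1) ^ 2 * ξ k ^ 2
    = ((Real.exp γ + Real.exp (-γ) - 2) / (Real.exp γ + Real.exp (-γ))) *
        (ξ k * (ξ (k + 1) - 2 * ξ k + ξ (k - 1)) + 2 * ξ k ^ 2)
      - (ξ (k + 1) - ξ k) * (ξ k - ξ (k - 1)) := by
  have hsq : Real.exp (2 * γ) = Real.exp γ ^ 2 := by
    rw [← Real.exp_nat_mul]; norm_num
  have up : ∀ j, S j = S k + 1 → ξ j = ξ k * (Real.exp γ)⁻¹ := fun j hj => by
    rw [hξ, hξ, hj, ← Real.exp_neg, ← Real.exp_add]; push_cast; ring_nf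
  have down : ∀ j, S j = S k - 1 → ξ j = ξ k * Real.exp γ := fun j hj => by
    rw [hξ, hξ, hj, ← Real.exp_add]; push_cast; ring_nf
  rw [hp, Real.exp_neg, Real.exp_neg, hsq]
  rcases (abs_eq one_pos.le).mp h1 with h | h <;>
    rcases (abs_eq one_pos.le).mp h2 with h' | h'
  · rw [if_neg (by lia), if_neg (by lia), up (k + 1) (by lia), down (k - 1) (by lia)]
    field_simp
    ring
  · rw [if_pos (by lia), if_neg (by lia), up (k + 1) (by lia), up (k - 1) (by lia)]
    field_simp
    ring
  · rw [if_neg (by lia), if_pos (by lia), down (k + 1) (by lia), down (k - 1) (by lia)]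
    field_simp
    ring
  · rw [if_neg (by lia), if_neg (by lia), down (k + 1) (by lia), up (k - 1) (by lia)]
    field_simp
    ring
end

section
/- Large deviation (Chernoff) tail bound for the discrete heat kernel on ℤ: for all c > 0, all t > 0 and all real a > 0, Σ_{k∈ℤ, k≥a} p̄_t(k) ≤ exp(2tc·g(a/(2ct))), where g(x) := √(1+x²) - x·arsinh(x) - 1. -/
/-- `n`-step simple random walk distribution on `ℤ`:
`q_n(ℓ) = 2^{-n}·binom(n,(n+ℓ)/2)` if `n+ℓ` is even and `|ℓ| ≤ n`, and `0` otherwise. -/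
noncomputable def rwStep (n : ℕ) (l : ℤ) : ℝ :=
  if ((n : ℤ) + l) % 2 = 0 ∧ |l| ≤ (n : ℤ) then
    ((1 : ℝ) / 2) ^ n * (Nat.choose n (((n : ℤ) + l) / 2).toNat : ℝ)
  else 0

/-- The discrete heat kernel on `ℤ` sped up by `2c`:
`p̄_t(ℓ) = e^{-2ct} Σ_{n≥0} ((2ct)^n/n!) q_n(ℓ)`. -/
noncomputable def heatKernelZ (c t : ℝ) (l : ℤ) : ℝ :=
  Real.exp (-(2 * c * t)) * ∑' n : ℕ, (2 * c * t) ^ n / (Nat.factorial n : ℝ) * rwStep n l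

/-- `g(x) = √(1+x²) - x·arsinh(x) - 1`. -/
noncomputable def gLD (x : ℝ) : ℝ := Real.sqrt (1 + x ^ 2) - x * Real.arsinh x - 1

theorem rwStep_nonneg (n : ℕ) (l : ℤ) : 0 ≤ rwStep n l := by
  unfold rwStep
  split_ifs <;> positivity

theorem rwStep_two_mul_sub (n k : ℕ) :
    rwStep n (2 * (k : ℤ) - n) = (1 / 2 : ℝ) ^ n * (n.choose k : ℝ) := by
  unfold rwStep
  have hk : (((n : ℤ) + (2 * (k : ℤ) - n)) / 2).toNat = k := by omega
  rw [hk]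
  split_ifs with h
  · rfl
  · have hlt : n < k := by
      by_contra hle
      exact h ⟨by omega, abs_le.mpr ⟨by omega, by omega⟩⟩
    simp [Nat.choose_eq_zero_of_lt hlt]

theorem rwStep_eq_zero_of_notMem_range (n : ℕ) (l : ℤ)
    (hl : l ∉ Set.range fun k : ℕ => 2 * (k : ℤ) - n) : rwStep n l = 0 := by
  unfold rwStep
  refine if_neg fun h => hl ⟨(((n : ℤ) + l) / 2).toNat, ?_⟩
  obtain ⟨h₁, h₂⟩ := h
  have := abs_le.mp h₂
  simp only
  omega

/-- The moment generating function of the simple random walk. -/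
theorem hasSum_rwStep_mul_exp (n : ℕ) (θ : ℝ) :
    HasSum (fun l : ℤ => rwStep n l * Real.exp (θ * l)) (Real.cosh θ ^ n) := by
  have hinj : Function.Injective fun k : ℕ => 2 * (k : ℤ) - n := fun i j h => by
    simp only at h
    omega
  rw [← hinj.hasSum_iff (f := fun l : ℤ => rwStep n l * Real.exp (θ * l)) fun l hl => by
    rw [rwStep_eq_zero_of_notMem_range n l hl, zero_mul]]
  have hcosh : Real.cosh θ ^ n = ∑ k ∈ Finset.range (n + 1),
      rwStep n (2 * (k : ℤ) - n) * Real.exp (θ * ((2 * (k : ℤ) - n : ℤ) : ℝ)) := by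
    rw [Real.cosh_eq, div_eq_mul_one_div, mul_pow, add_pow, Finset.sum_mul]
    refine Finset.sum_congr rfl fun k hk => ?_
    have hkn : k ≤ n := Nat.lt_succ_iff.mp (Finset.mem_range.mp hk)
    rw [rwStep_two_mul_sub, ← Real.exp_nat_mul, ← Real.exp_nat_mul, ← Real.exp_add,
      Nat.cast_sub hkn]
    push_cast
    ring_nf
  rw [hcosh]
  refine hasSum_sum_of_ne_finset_zero fun k hk => ?_
  have hnk : n < k := by simpa using hk
  simp [rwStep_two_mul_sub, Nat.choose_eq_zero_of_lt hnk]

theorem heatKernelZ_nonneg {c t : ℝ} (hc : 0 ≤ c) (ht : 0 ≤ t) (l : ℤ) :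
    0 ≤ heatKernelZ c t l :=
  mul_nonneg (Real.exp_pos _).le <| tsum_nonneg fun n =>
    mul_nonneg (by positivity) (rwStep_nonneg n l)

/-- The moment generating function of the heat kernel. -/
theorem hasSum_heatKernelZ_mul_exp {c t : ℝ} (hc : 0 ≤ c) (ht : 0 ≤ t) (θ : ℝ) :
    HasSum (fun l : ℤ => heatKernelZ c t l * Real.exp (θ * l))
      (Real.exp (2 * c * t * (Real.cosh θ - 1))) := by
  set x := 2 * c * t with hx
  have hx0 : 0 ≤ x := by positivity
  let F : ℕ × ℤ → ℝ := fun p =>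
    x ^ p.1 / (p.1.factorial : ℝ) * (rwStep p.1 p.2 * Real.exp (θ * p.2))
  have hrow (n : ℕ) : HasSum (fun l => F (n, l)) ((x * Real.cosh θ) ^ n / (n.factorial : ℝ)) := by
    convert! (hasSum_rwStep_mul_exp n θ).mul_left (x ^ n / (n.factorial : ℝ)) using 1
    ring
  have hexp : HasSum (fun n : ℕ => (x * Real.cosh θ) ^ n / (n.factorial : ℝ))
      (Real.exp (x * Real.cosh θ)) := by
    rw [Real.exp_eq_exp_ℝ]
    exact NormedSpace.expSeries_div_hasSum_exp _
  have hF0 : 0 ≤ F := fun p =>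
    mul_nonneg (by positivity) (mul_nonneg (rwStep_nonneg _ _) (Real.exp_pos _).le)
  have hF : Summable F := (summable_prod_of_nonneg hF0).mpr
    ⟨fun n => (hrow n).summable, by simpa only [(hrow _).tsum_eq] using hexp.summable⟩
  have htot : HasSum F (Real.exp (x * Real.cosh θ)) := by
    rw [hexp.unique (hF.hasSum.prod_fiberwise hrow)]
    exact hF.hasSum
  have hswap : HasSum (fun p : ℤ × ℕ => F p.swap) (Real.exp (x * Real.cosh θ)) :=
    (Equiv.prodComm ℤ ℕ).hasSum_iff.mpr htot
  have hcol := hswap.prod_fiberwise fun l => (hswap.summable.prod_factor l).hasSum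
  convert! hcol.mul_left (Real.exp (-x)) using 1
  · funext l
    simp only [heatKernelZ, F, Prod.swap, ← mul_assoc, tsum_mul_right, ← hx]
  · rw [← Real.exp_add]
    ring_nf

theorem mul_gLD_eq {x : ℝ} (hx : x ≠ 0) (a : ℝ) :
    x * gLD (a / x) =
      x * (Real.cosh (Real.arsinh (a / x)) - 1) - Real.arsinh (a / x) * a := by
  rw [gLD, Real.cosh_arsinh]
  field_simp
  ring

/-- Chernoff tail bound for the discrete heat kernel on `ℤ`:
`Σ_{k≥a} p̄_t(k) ≤ exp(2tc·g(a/(2ct)))`. -/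
theorem heatKernelZ_tail_bound (c t a : ℝ) (hc : 0 < c) (ht : 0 < t) (ha : 0 < a) :
    ∑' k : { k : ℤ // a ≤ (k : ℝ) }, heatKernelZ c t (k : ℤ)
      ≤ Real.exp (2 * t * c * gLD (a / (2 * c * t))) := by
  have hx : 0 < 2 * c * t := by positivity
  set θ := Real.arsinh (a / (2 * c * t)) with hθ
  have hθ0 : 0 ≤ θ := Real.arsinh_nonneg_iff.mpr (by positivity)
  have hsum := (hasSum_heatKernelZ_mul_exp hc.le ht.le θ).mul_left (Real.exp (-(θ * a)))
  have hnonneg (k : ℤ) : 0 ≤ Real.exp (-(θ * a)) * (heatKernelZ c t k * Real.exp (θ * k)) :=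
    mul_nonneg (Real.exp_pos _).le
      (mul_nonneg (heatKernelZ_nonneg hc.le ht.le k) (Real.exp_pos _).le)
  have hle (k : { k : ℤ // a ≤ (k : ℝ) }) : heatKernelZ c t k ≤
      Real.exp (-(θ * a)) * (heatKernelZ c t k * Real.exp (θ * (k : ℤ))) := by
    rw [mul_left_comm, ← Real.exp_add]
    refine le_mul_of_one_le_right (heatKernelZ_nonneg hc.le ht.le k) (Real.one_le_exp ?_)
    linarith [mul_le_mul_of_nonneg_left k.2 hθ0]
  have hsub := hsum.summable.subtype {k : ℤ | a ≤ (k : ℝ)}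
  have hheat : Summable fun k : { k : ℤ // a ≤ (k : ℝ) } => heatKernelZ c t k :=
    hsub.of_nonneg_of_le (fun k => heatKernelZ_nonneg hc.le ht.le k) hle
  calc ∑' k : { k : ℤ // a ≤ (k : ℝ) }, heatKernelZ c t (k : ℤ)
      ≤ ∑' k : { k : ℤ // a ≤ (k : ℝ) },
          Real.exp (-(θ * a)) * (heatKernelZ c t k * Real.exp (θ * (k : ℤ))) :=
        hheat.tsum_le_tsum hle hsub
    _ ≤ ∑' k : ℤ, Real.exp (-(θ * a)) * (heatKernelZ c t k * Real.exp (θ * k)) :=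
        hsum.summable.tsum_subtype_le _ {k : ℤ | a ≤ (k : ℝ)} hnonneg
    _ = Real.exp (2 * t * c * gLD (a / (2 * c * t))) := by
        rw [hsum.tsum_eq, ← Real.exp_add, mul_right_comm 2 t c, mul_gLD_eq hx.ne', ← hθ]
        ring_nf
end

section
/- The function x ↦ g(x)/x is strictly decreasing on (0,∞), where g(x) := √(1+x²) - x·arsinh(x) - 1. Consequently, for every fixed a > 0 and c > 0, the function t ↦ exp(2tc·g(a/(2ct))) is nondecreasing on (0,∞). -/
theorem hasDerivAt_gLD (x : ℝ) : HasDerivAt gLD (-Real.arsinh x) x := by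
  have hs : HasDerivAt (fun y : ℝ => √(1 + y ^ 2)) (2 * x / (2 * √(1 + x ^ 2))) x := by
    have h : HasDerivAt (fun y : ℝ => 1 + y ^ 2) (2 * x) x := by
      simpa using (hasDerivAt_pow 2 x).const_add 1
    exact h.sqrt (by positivity)
  refine ((hs.sub ((hasDerivAt_id x).mul (Real.hasDerivAt_arsinh x))).sub_const 1).congr_deriv ?_
  have : 0 < √(1 + x ^ 2) := by positivity
  simp only [id]
  field_simp
  ring

theorem hasDerivAt_gLD_div {x : ℝ} (hx : x ≠ 0) :
    HasDerivAt (fun y => gLD y / y) ((1 - √(1 + x ^ 2)) / x ^ 2) x := by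
  refine ((hasDerivAt_gLD x).div (hasDerivAt_id x) hx).congr_deriv ?_
  simp only [id, gLD]
  ring

theorem strictAntiOn_gLD_div : StrictAntiOn (fun x : ℝ => gLD x / x) (Set.Ioi (0 : ℝ)) := by
  refine strictAntiOn_of_hasDerivWithinAt_neg (convex_Ioi 0)
    (f' := fun x => (1 - √(1 + x ^ 2)) / x ^ 2)
    (fun x hx => (hasDerivAt_gLD_div (ne_of_gt hx)).continuousAt.continuousWithinAt) ?_ ?_
  all_goals
    intro x hx
    replace hx : 0 < x := by simpa using hx
  · exact (hasDerivAt_gLD_div hx.ne').hasDerivWithinAt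
  · have hsqrt : 1 < √(1 + x ^ 2) := by
      rw [Real.lt_sqrt zero_le_one]
      nlinarith
    exact div_neg_of_neg_of_pos (by linarith) (by positivity)

/-- `x ↦ g(x)/x` is strictly decreasing on `(0,∞)`; consequently, for fixed `a, c > 0`,
`t ↦ exp(2tc·g(a/(2ct)))` is nondecreasing on `(0,∞)`. -/
theorem gLD_div_strictAntiOn :
    StrictAntiOn (fun x : ℝ => gLD x / x) (Set.Ioi (0 : ℝ)) ∧
    ∀ a c : ℝ, 0 < a → 0 < c →
      MonotoneOn (fun t : ℝ => Real.exp (2 * t * c * gLD (a / (2 * c * t))))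
        (Set.Ioi (0 : ℝ)) := by
  refine ⟨strictAntiOn_gLD_div, fun a c ha hc t ht u hu htu => ?_⟩
  rw [Set.mem_Ioi] at ht hu
  have rescale : ∀ r : ℝ, 0 < r → 2 * r * c * gLD (a / (2 * c * r)) =
      a * (gLD (a / (2 * c * r)) / (a / (2 * c * r))) := by
    intro r hr
    generalize gLD (a / (2 * c * r)) = y
    field_simp
  refine Real.exp_le_exp.2 ?_
  rw [rescale t ht, rescale u hu]
  refine mul_le_mul_of_nonneg_left (strictAntiOn_gLD_div.antitoneOn ?_ ?_ ?_) ha.le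
  · exact Set.mem_Ioi.2 (by positivity)
  · exact Set.mem_Ioi.2 (by positivity)
  · gcongr
end

section
/- Uniform on-diagonal decay of the discrete heat kernel on ℤ: there exists a constant C > 0 such that for all c > 0, all t > 0 and all ℓ ∈ ℤ, p̄_t(ℓ) ≤ C/√(ct). -/
theorem sq_centralBinom_mul_le (m : ℕ) :
    m.centralBinom ^ 2 * (2 * m + 1) ≤ 4 ^ (2 * m) := by
  induction m with
  | zero => simp
  | succ m ih =>
    have h := Nat.succ_mul_centralBinom_succ m
    refine Nat.le_of_mul_le_mul_left (c := (m + 1) ^ 2) ?_ (by positivity)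
    calc (m + 1) ^ 2 * ((m + 1).centralBinom ^ 2 * (2 * (m + 1) + 1))
        = ((m + 1) * (m + 1).centralBinom) ^ 2 * (2 * m + 3) := by ring
      _ = (m.centralBinom ^ 2 * (2 * m + 1)) * (4 * ((2 * m + 1) * (2 * m + 3))) := by
        rw [h]; ring
      _ ≤ 4 ^ (2 * m) * (4 * (4 * (m + 1) ^ 2)) := by
        gcongr ?_ * (4 * ?_)
        nlinarith
      _ = (m + 1) ^ 2 * 4 ^ (2 * (m + 1)) := by ring

theorem sq_choose_mul_le (n k : ℕ) : n.choose k ^ 2 * (n + 1) ≤ 4 ^ n := by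
  refine (Nat.mul_le_mul_right _ (Nat.pow_le_pow_left (Nat.choose_le_middle k n) 2)).trans ?_
  obtain ⟨m, rfl | rfl⟩ := n.even_or_odd'
  · simpa [Nat.centralBinom] using sq_centralBinom_mul_le m
  · have hm : (2 * m + 1) / 2 = m := by omega
    have hc : (m + 1).centralBinom = 2 * (2 * m + 1).choose m := by
      rw [Nat.centralBinom, show 2 * (m + 1) = 2 * m + 1 + 1 by ring, Nat.choose_succ_succ,
        Nat.choose_symm_half]
      ring
    have h := sq_centralBinom_mul_le (m + 1)
    rw [hc, show 2 * (m + 1) = 2 * m + 1 + 1 by ring, pow_succ 4] at h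
    rw [hm]
    nlinarith [Nat.zero_le ((2 * m + 1).choose m ^ 2)]

theorem sq_rwStep_le (n : ℕ) (l : ℤ) : rwStep n l ^ 2 ≤ 1 / ((n : ℝ) + 1) := by
  unfold rwStep
  split_ifs
  · set k := (((n : ℤ) + l) / 2).toNat
    have h : (n.choose k : ℝ) ^ 2 * (n + 1) ≤ 4 ^ n := mod_cast sq_choose_mul_le n k
    rw [le_div_iff₀ (by positivity)]
    calc ((1 / 2 : ℝ) ^ n * n.choose k) ^ 2 * (n + 1)
        = (1 / 4) ^ n * ((n.choose k : ℝ) ^ 2 * (n + 1)) := by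
          rw [mul_pow, ← pow_mul, mul_comm n 2, pow_mul]
          norm_num [mul_assoc]
      _ ≤ (1 / 4) ^ n * 4 ^ n := by gcongr
      _ = 1 := by rw [← mul_pow]; norm_num
  · simp only [ne_eq, OfNat.ofNat_ne_zero, not_false_eq_true, zero_pow]
    positivity

theorem rwStep_le_of_pos {r : ℝ} (hr : 0 < r) (n : ℕ) (l : ℤ) :
    rwStep n l ≤ (r / ((n : ℝ) + 1) + 1 / r) / 2 := by
  have h := mul_le_mul_of_nonneg_left (sq_rwStep_le n l) hr.le
  have h' : 2 * rwStep n l ≤ r * rwStep n l ^ 2 + 1 / r := by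
    have : r * rwStep n l ^ 2 + 1 / r - 2 * rwStep n l = (r * rwStep n l - 1) ^ 2 / r := by
      field_simp
      ring
    have : 0 ≤ (r * rwStep n l - 1) ^ 2 / r := by positivity
    linarith
  rw [mul_one_div] at h
  linarith

theorem hasSum_pow_div_factorial (s : ℝ) :
    HasSum (fun n : ℕ => s ^ n / (n.factorial : ℝ)) (Real.exp s) := by
  rw [Real.exp_eq_exp_ℝ]
  exact NormedSpace.expSeries_div_hasSum_exp s

theorem hasSum_pow_div_factorial_div_succ {s : ℝ} (hs : s ≠ 0) :
    HasSum (fun n : ℕ => s ^ n / (n.factorial : ℝ) / ((n : ℝ) + 1)) ((Real.exp s - 1) / s) := by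
  have h := ((hasSum_nat_add_iff' 1).mpr (hasSum_pow_div_factorial s)).div_const s
  simp only [Finset.range_one, Finset.sum_singleton, pow_zero, Nat.factorial_zero, Nat.cast_one,
    div_one] at h
  refine h.congr_fun ?_
  intro n
  rw [Nat.factorial_succ]
  push_cast
  field_simp
  ring

theorem heatKernelZ_le_one_div_sqrt {c t : ℝ} (h : 0 < c * t) (l : ℤ) :
    heatKernelZ c t l ≤ 1 / Real.sqrt (2 * c * t) := by
  unfold heatKernelZ
  have hs : 0 < 2 * c * t := by linarith
  generalize 2 * c * t = s at hs
  have hr : 0 < √s := Real.sqrt_pos.mpr hs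
  have hrs : √s ^ 2 = s := Real.sq_sqrt hs.le
  have hle : ∀ n : ℕ, s ^ n / (n.factorial : ℝ) * rwStep n l ≤
      s ^ n / (n.factorial : ℝ) / ((n : ℝ) + 1) * (√s / 2) +
        s ^ n / (n.factorial : ℝ) * (1 / √s / 2) := fun n =>
    (mul_le_mul_of_nonneg_left (rwStep_le_of_pos hr n l) (by positivity)).trans_eq (by ring)
  have hsum := ((hasSum_pow_div_factorial_div_succ hs.ne').mul_right (√s / 2)).add
    ((hasSum_pow_div_factorial s).mul_right (1 / √s / 2))
  have hsummable := Summable.of_nonneg_of_le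
    (fun n => mul_nonneg (by positivity) (rwStep_nonneg n l)) hle hsum.summable
  calc Real.exp (-s) * ∑' n : ℕ, s ^ n / (n.factorial : ℝ) * rwStep n l
      ≤ Real.exp (-s) * ((Real.exp s - 1) / s * (√s / 2) + Real.exp s * (1 / √s / 2)) := by
        gcongr
        exact hasSum_le hle hsummable.hasSum hsum
    _ ≤ Real.exp (-s) * (Real.exp s / s * (√s / 2) + Real.exp s * (1 / √s / 2)) := by
        gcongr
        linarith
    _ = (Real.exp (-s) * Real.exp s) * (√s / s / 2 + 1 / √s / 2) := by ring
    _ = 1 / √s := by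
        rw [← Real.exp_add, neg_add_cancel, Real.exp_zero, Real.sqrt_div_self']
        ring

/-- Uniform on-diagonal decay of the discrete heat kernel on `ℤ`:
`p̄_t(ℓ) ≤ C/√(ct)` for a universal constant `C > 0`. -/
theorem heatKernelZ_ondiag_decay :
    ∃ C : ℝ, 0 < C ∧ ∀ c t : ℝ, 0 < c → 0 < t → ∀ l : ℤ,
      heatKernelZ c t l ≤ C / Real.sqrt (c * t) := by
  refine ⟨1, one_pos, fun c t hc ht l => ?_⟩
  have h : 0 < c * t := mul_pos hc ht
  refine (heatKernelZ_le_one_div_sqrt h l).trans ?_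
  gcongr
  linarith
end

section
/- Discrete parabolic comparison (maximum) principle: let n ≥ 1, let A be the n×n matrix with A_{k,k} = -2, A_{k,k±1} = 1 and all other entries 0, let c > 0 and T > 0, and let w : [0,T] → ℝⁿ be differentiable with w'(t)_ℓ ≥ c·(A·w(t))_ℓ for every t ∈ [0,T] and every ℓ ∈ {1,…,n}. If w(0)_ℓ ≥ 0 for all ℓ, then w(t)_ℓ ≥ 0 for all t ∈ [0,T] and all ℓ. -/
/-- The `n×n` discrete Laplacian matrix with Dirichlet boundary conditions:
`A_{k,k} = -2`, `A_{k,k±1} = 1`, other entries `0`. -/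
def dirLap (n : ℕ) : Matrix (Fin n) (Fin n) ℝ :=
  Matrix.of fun i j =>
    if (i : ℤ) = (j : ℤ) then -2
    else if (i : ℤ) = (j : ℤ) + 1 ∨ (j : ℤ) = (i : ℤ) + 1 then 1 else 0

theorem dirLap_nonneg_of_ne {n : ℕ} {i j : Fin n} (h : i ≠ j) : 0 ≤ dirLap n i j := by
  have hij : (i : ℤ) ≠ (j : ℤ) := by simpa [Fin.ext_iff] using h
  simp only [dirLap, Matrix.of_apply, if_neg hij]
  split_ifs <;> norm_num

theorem sum_dirLap_row_nonpos {n : ℕ} (i : Fin n) : ∑ j, dirLap n i j ≤ 0 := by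
  have hentry : ∀ j, dirLap n i j ≤ -2 * (if i = j then 1 else 0) +
      (if (i : ℕ) = j + 1 then 1 else 0) + (if (j : ℕ) = i + 1 then 1 else 0) := by
    intro j
    simp only [dirLap, Matrix.of_apply, Fin.ext_iff]
    split_ifs <;> first | omega | norm_num
  have hle_one : ∀ p : Fin n → Prop, [DecidablePred p] → (∀ a b, p a → p b → a = b) →
      ∑ j, (if p j then (1 : ℝ) else 0) ≤ 1 := by
    intro p _ hp
    rw [Finset.sum_boole]
    exact_mod_cast Finset.card_le_one.2 fun a ha b hb =>
      hp a b (Finset.mem_filter.1 ha).2 (Finset.mem_filter.1 hb).2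
  have hleft := hle_one (fun j => (i : ℕ) = j + 1) fun a b ha hb => Fin.ext (by omega)
  have hright := hle_one (fun j => (j : ℕ) = i + 1) fun a b ha hb => Fin.ext (by omega)
  have hsum := Finset.sum_le_sum fun j (_ : j ∈ Finset.univ) => hentry j
  rw [Finset.sum_add_distrib, Finset.sum_add_distrib, ← Finset.mul_sum,
    Finset.sum_ite_eq, if_pos (Finset.mem_univ i)] at hsum
  linarith

/-- At a nonpositive minimum of `v`, the discrete Laplacian of `v` is nonnegative. -/
theorem dirLap_mulVec_nonneg_of_isMin {n : ℕ} {v : Fin n → ℝ} {i : Fin n}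
    (hmin : ∀ j, v i ≤ v j) (hi : v i ≤ 0) : 0 ≤ (dirLap n).mulVec v i := by
  calc
    0 ≤ (∑ j, dirLap n i j) * v i := mul_nonneg_of_nonpos_of_nonpos (sum_dirLap_row_nonpos i) hi
    _ = ∑ j, dirLap n i j * v i := Finset.sum_mul ..
    _ ≤ ∑ j, dirLap n i j * v j := Finset.sum_le_sum fun j _ => by
      rcases eq_or_ne i j with rfl | hij
      · exact le_rfl
      · exact mul_le_mul_of_nonneg_left (hmin j) (dirLap_nonneg_of_ne hij)

/-- At a minimum over `[a, b]` other than the left endpoint, the derivative is nonpositive. -/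
theorem IsMinOn.hasDerivWithinAt_Icc_nonpos {f : ℝ → ℝ} {f' a b t : ℝ}
    (hmin : IsMinOn f (Set.Icc a b) t) (hf : HasDerivWithinAt f f' (Set.Icc a b) t)
    (hat : a < t) (htb : t ≤ b) : f' ≤ 0 := by
  have hdir : a - t ∈ posTangentConeAt (Set.Icc a b) t :=
    sub_mem_posTangentConeAt_of_segment_subset <|
      (convex_Icc a b).segment_subset ⟨hat.le, htb⟩ ⟨le_rfl, hat.le.trans htb⟩
  have h := hmin.localize.hasFDerivWithinAt_nonneg hf.hasFDerivWithinAt hdir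
  simp only [ContinuousLinearMap.toSpanSingleton_apply, smul_eq_mul] at h
  nlinarith

/-- Discrete parabolic comparison (maximum) principle: if `w : [0,T] → ℝⁿ` is
differentiable with `w'(t)_ℓ ≥ c·(A w(t))_ℓ` on `[0,T]` and `w(0) ≥ 0` componentwise,
then `w(t) ≥ 0` componentwise on `[0,T]`. -/
theorem discrete_maximum_principle (n : ℕ) (hn : 1 ≤ n) (c T : ℝ) (hc : 0 < c) (hT : 0 < T)
    (w w' : ℝ → Fin n → ℝ)
    (hderiv : ∀ t ∈ Set.Icc (0 : ℝ) T, HasDerivWithinAt w (w' t) (Set.Icc (0 : ℝ) T) t)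
    (hsuper : ∀ t ∈ Set.Icc (0 : ℝ) T, ∀ l : Fin n,
      c * (dirLap n).mulVec (w t) l ≤ w' t l)
    (h0 : ∀ l : Fin n, 0 ≤ w 0 l) :
    ∀ t ∈ Set.Icc (0 : ℝ) T, ∀ l : Fin n, 0 ≤ w t l := by
  intro t ht l
  by_contra! hneg
  set ε := -w t l / (2 * T)
  have hε : 0 < ε := div_pos (by linarith) (by linarith)
  have hεT : ε * T = -w t l / 2 := by simp only [ε]; field_simp
  let v : Fin n → ℝ → ℝ := fun k s => w s k + ε * s
  have hv : ∀ k, ∀ s ∈ Set.Icc (0 : ℝ) T,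
      HasDerivWithinAt (v k) (w' s k + ε) (Set.Icc 0 T) s := fun k s hs => by
    have h := (hasDerivWithinAt_pi.1 (hderiv s hs) k).add
      ((hasDerivWithinAt_id s (Set.Icc 0 T)).const_mul ε)
    rw [mul_one] at h
    exact h
  choose τ hτ hτmin using fun k => isCompact_Icc.exists_isMinOn ⟨t, ht⟩
    (fun s hs => (hv k s hs).continuousWithinAt : ContinuousOn (v k) (Set.Icc 0 T))
  have : Nonempty (Fin n) := ⟨l⟩
  obtain ⟨k, hk⟩ := Finite.exists_min fun k => v k (τ k)
  have hmin : ∀ j, ∀ s ∈ Set.Icc (0 : ℝ) T, v k (τ k) ≤ v j s :=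
    fun j s hs => (hk j).trans (hτmin j hs)
  have hvneg : w (τ k) k + ε * τ k < 0 := by
    have h : w (τ k) k + ε * τ k ≤ w t l + ε * t := hmin l t ht
    have := mul_le_mul_of_nonneg_left ht.2 hε.le
    linarith
  have hτpos : 0 < τ k := (hτ k).1.lt_of_ne fun h => by
    rw [← h] at hvneg
    linarith [h0 k]
  have hw' := (hτmin k).hasDerivWithinAt_Icc_nonpos (hv k _ (hτ k)) hτpos (hτ k).2
  have hlap : 0 ≤ (dirLap n).mulVec (w (τ k)) k :=
    dirLap_mulVec_nonneg_of_isMin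
      (fun j => le_of_add_le_add_right (hmin j (τ k) (hτ k)))
      (by linarith [mul_pos hε hτpos])
  linarith [hsuper _ (hτ k) k, mul_nonneg hc.le hlap]
end

section
/- The explicit profile arising as hydrodynamic limit from the flat initial condition is a Kruzkov entropy solution: define η : (0,∞) × (0,1) → ℝ by η(t,x) := 1 if x < min(t, 1/2), η(t,x) := 0 if x > 1 - min(t, 1/2), and η(t,x) := 1/2 otherwise. Then for every c ∈ [0,1] and every smooth, compactly supported, nonnegative test function φ on (0,∞) × (0,1), ∫_0^∞ ∫_0^1 ( |η(t,x) - c|·∂_t φ(t,x) - 2·sgn(η(t,x) - c)·(η(t,x)(1-η(t,x)) - c(1-c))·∂_x φ(t,x) ) dx dt ≥ 0; moreover lim_{t↓0} ∫_0^1 |η(t,x) - 1/2| dx = 0. -/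
open MeasureTheory

/-- The explicit hydrodynamic-limit density profile from the flat initial condition:
`η(t,x) = 1` for `x < min(t,1/2)`, `η(t,x) = 0` for `x > 1 - min(t,1/2)`, `η(t,x) = 1/2`
otherwise. -/
noncomputable def etaFlat (t x : ℝ) : ℝ :=
  if x < min t (1 / 2) then 1 else if 1 - min t (1 / 2) < x then 0 else 1 / 2

section Slices

variable {φ : ℝ × ℝ → ℝ}

/-- A compactly supported function on the plane has compact support along every graph over the
first coordinate. -/
lemma HasCompactSupport.comp_graph_fst (hc : HasCompactSupport φ) (m : ℝ → ℝ) :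
    HasCompactSupport (fun s => φ (s, m s)) := by
  refine HasCompactSupport.intro (hc.isCompact.image continuous_fst) fun s hs => ?_
  exact image_eq_zero_of_notMem_tsupport fun h => hs ⟨_, h, rfl⟩

/-- A compactly supported function on the plane has compact support along vertical lines. -/
lemma HasCompactSupport.comp_vertical (hc : HasCompactSupport φ) (t : ℝ) :
    HasCompactSupport (fun x => φ (t, x)) := by
  refine HasCompactSupport.intro (hc.isCompact.image continuous_snd) fun s hs => ?_
  exact image_eq_zero_of_notMem_tsupport fun h => hs ⟨_, h, rfl⟩

lemma fderiv_apply_one_zero (h : ContDiff ℝ 1 φ) (t x : ℝ) :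
    fderiv ℝ φ (t, x) (1, 0) = deriv (fun s => φ (s, x)) t := by
  have h1 : HasFDerivAt φ (fderiv ℝ φ (t, x)) (t, x) :=
    (h.differentiable one_ne_zero _).hasFDerivAt
  exact (h1.comp_hasDerivAt t ((hasDerivAt_id t).prodMk (hasDerivAt_const t x))).deriv.symm

lemma fderiv_apply_zero_one (h : ContDiff ℝ 1 φ) (t x : ℝ) :
    fderiv ℝ φ (t, x) (0, 1) = deriv (fun y => φ (t, y)) x := by
  have h1 : HasFDerivAt φ (fderiv ℝ φ (t, x)) (t, x) :=
    (h.differentiable one_ne_zero _).hasFDerivAt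
  exact (h1.comp_hasDerivAt x ((hasDerivAt_const x t).prodMk (hasDerivAt_id x))).deriv.symm

lemma integrable_fderiv_apply (h : ContDiff ℝ 1 φ) (hc : HasCompactSupport φ) (v : ℝ × ℝ) :
    Integrable (fun p => fderiv ℝ φ p v) :=
  ((h.continuous_fderiv one_ne_zero).clm_apply continuous_const).integrable_of_hasCompactSupport
    (hc.fderiv_apply ℝ v)

lemma integral_deriv_eq_zero_of_hasCompactSupport {f : ℝ → ℝ} (h : ContDiff ℝ 1 f)
    (hc : HasCompactSupport f) : ∫ x, deriv f x = 0 :=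
  integral_eq_zero_of_hasDerivAt_of_integrable
    (fun x => (h.differentiable one_ne_zero x).hasDerivAt)
    ((h.continuous_deriv le_rfl).integrable_of_hasCompactSupport hc.deriv)
    (h.continuous.integrable_of_hasCompactSupport hc)

lemma contDiff_slice_fst (h : ContDiff ℝ 1 φ) (x : ℝ) : ContDiff ℝ 1 (fun s => φ (s, x)) :=
  h.comp (contDiff_id.prodMk contDiff_const)

lemma contDiff_slice_snd (h : ContDiff ℝ 1 φ) (t : ℝ) : ContDiff ℝ 1 (fun x => φ (t, x)) :=
  h.comp (contDiff_const.prodMk contDiff_id)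

lemma integral_fderiv_one_zero (h : ContDiff ℝ 1 φ) (hc : HasCompactSupport φ) :
    ∫ p, fderiv ℝ φ p (1, 0) = 0 := by
  have hi := integrable_fderiv_apply h hc (1, 0)
  rw [Measure.volume_eq_prod] at hi ⊢
  rw [integral_prod_symm _ hi]
  simp_rw [fderiv_apply_one_zero h]
  simp [integral_deriv_eq_zero_of_hasCompactSupport (contDiff_slice_fst h _)
    (hc.comp_graph_fst fun _ => _)]

lemma integral_fderiv_zero_one (h : ContDiff ℝ 1 φ) (hc : HasCompactSupport φ) :
    ∫ p, fderiv ℝ φ p (0, 1) = 0 := by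
  have hi := integrable_fderiv_apply h hc (0, 1)
  rw [Measure.volume_eq_prod] at hi ⊢
  rw [integral_prod _ hi]
  simp_rw [fderiv_apply_zero_one h]
  simp [integral_deriv_eq_zero_of_hasCompactSupport (contDiff_slice_snd h _)
    (hc.comp_vertical _)]

end Slices

/-- The region where the profile equals `1`. -/
def fullRegion : Set (ℝ × ℝ) := {p | p.2 < min p.1 (1 / 2)}

/-- The region where the profile equals `0`. -/
def emptyRegion : Set (ℝ × ℝ) := {p | 1 - min p.1 (1 / 2) < p.2}

lemma measurableSet_fullRegion : MeasurableSet fullRegion :=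
  measurableSet_lt measurable_snd (measurable_fst.min measurable_const)

lemma measurableSet_emptyRegion : MeasurableSet emptyRegion :=
  measurableSet_lt (measurable_const.sub (measurable_fst.min measurable_const)) measurable_snd

section Regions

variable {φ : ℝ × ℝ → ℝ}

lemma integral_fullRegion_fderiv_one_zero (h : ContDiff ℝ 1 φ) (hc : HasCompactSupport φ) :
    ∫ p in fullRegion, fderiv ℝ φ p (1, 0) = -∫ s in Set.Iio (1 / 2 : ℝ), φ (s, s) := by
  have hi := (integrable_fderiv_apply h hc (1, 0)).indicator measurableSet_fullRegion
  rw [← integral_indicator measurableSet_fullRegion]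
  rw [Measure.volume_eq_prod] at hi ⊢
  rw [integral_prod_symm _ hi, ← integral_neg, ← integral_indicator measurableSet_Iio]
  congr 1 with x
  by_cases hx : x < 1 / 2
  · rw [Set.indicator_of_mem (Set.mem_Iio.2 hx),
      ← (hc.comp_graph_fst fun _ => x).integral_Ioi_deriv_eq (contDiff_slice_fst h x) x,
      ← integral_indicator measurableSet_Ioi]
    congr 1 with t
    simp only [Set.indicator_apply, fullRegion, Set.mem_ofPred_eq, lt_min_iff, hx, and_true,
      Set.mem_Ioi, fderiv_apply_one_zero h]
  · simp only [Set.indicator_apply, fullRegion, Set.mem_ofPred_eq, lt_min_iff, hx, and_false,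
      Set.mem_Iio, if_false, integral_zero]

lemma integral_fullRegion_fderiv_zero_one (h : ContDiff ℝ 1 φ) (hc : HasCompactSupport φ) :
    ∫ p in fullRegion, fderiv ℝ φ p (0, 1) =
      (∫ s in Set.Iio (1 / 2 : ℝ), φ (s, s)) + ∫ s in Set.Ici (1 / 2 : ℝ), φ (s, 1 / 2) := by
  have hi := (integrable_fderiv_apply h hc (0, 1)).indicator measurableSet_fullRegion
  rw [← integral_indicator measurableSet_fullRegion]
  rw [Measure.volume_eq_prod] at hi ⊢
  rw [integral_prod _ hi]
  have hinner (t : ℝ) : ∫ x, fullRegion.indicator (fun p => fderiv ℝ φ p (0, 1)) (t, x) =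
      φ (t, min t (1 / 2)) := by
    rw [← (hc.comp_vertical t).integral_Iic_deriv_eq (contDiff_slice_snd h t) (min t (1 / 2)),
      integral_Iic_eq_integral_Iio, ← integral_indicator measurableSet_Iio]
    congr 1 with x
    simp only [Set.indicator_apply, fullRegion, Set.mem_ofPred_eq, Set.mem_Iio,
      fderiv_apply_zero_one h]
  have hIntegrable : Integrable (fun t => φ (t, min t (1 / 2))) :=
    (h.continuous.comp (continuous_id.prodMk (continuous_id.min
      continuous_const))).integrable_of_hasCompactSupport (hc.comp_graph_fst _)
  simp_rw [hinner]
  rw [← integral_add_compl (measurableSet_Iio (a := (1 / 2 : ℝ))) hIntegrable, Set.compl_Iio]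
  congr 1
  · refine setIntegral_congr_fun measurableSet_Iio fun t ht => ?_
    simp only [min_eq_left (Set.mem_Iio.1 ht).le]
  · refine setIntegral_congr_fun measurableSet_Ici fun t ht => ?_
    simp only [min_eq_right (Set.mem_Ici.1 ht)]

/-- The reflection `(t, x) ↦ (t, 1 - x)`, which exchanges the two regions. -/
def reflect : ℝ × ℝ ≃ₜ ℝ × ℝ := (Homeomorph.refl ℝ).prodCongr (Homeomorph.subLeft 1)

@[simp] lemma reflect_apply (t x : ℝ) : reflect (t, x) = (t, 1 - x) := rfl

lemma measurePreserving_reflect : MeasurePreserving reflect volume volume :=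
  (MeasurePreserving.id volume).prod (Measure.measurePreserving_sub_left volume (1 : ℝ))

lemma setIntegral_emptyRegion (f : ℝ × ℝ → ℝ) :
    ∫ p in emptyRegion, f p = ∫ p in fullRegion, f (reflect p) := by
  have hpre : fullRegion = reflect ⁻¹' emptyRegion := by
    ext ⟨t, x⟩
    simp [fullRegion, emptyRegion]
  rw [hpre, measurePreserving_reflect.setIntegral_preimage_emb reflect.measurableEmbedding]

lemma contDiff_comp_reflect (h : ContDiff ℝ 1 φ) : ContDiff ℝ 1 (φ ∘ reflect) :=
  h.comp (contDiff_fst.prodMk (contDiff_const.sub contDiff_snd))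

lemma fderiv_comp_reflect_one_zero (h : ContDiff ℝ 1 φ) (p : ℝ × ℝ) :
    fderiv ℝ φ (reflect p) (1, 0) = fderiv ℝ (φ ∘ reflect) p (1, 0) := by
  obtain ⟨t, x⟩ := p
  rw [fderiv_apply_one_zero (contDiff_comp_reflect h), reflect_apply, fderiv_apply_one_zero h]
  rfl

lemma fderiv_comp_reflect_zero_one (h : ContDiff ℝ 1 φ) (p : ℝ × ℝ) :
    fderiv ℝ φ (reflect p) (0, 1) = -fderiv ℝ (φ ∘ reflect) p (0, 1) := by
  obtain ⟨t, x⟩ := p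
  rw [fderiv_apply_zero_one (contDiff_comp_reflect h), reflect_apply, fderiv_apply_zero_one h]
  simp only [Function.comp_apply, reflect_apply]
  rw [deriv_comp_const_sub (f := fun y => φ (t, y)), neg_neg]

lemma integral_emptyRegion_fderiv_one_zero (h : ContDiff ℝ 1 φ) (hc : HasCompactSupport φ) :
    ∫ p in emptyRegion, fderiv ℝ φ p (1, 0) = -∫ s in Set.Iio (1 / 2 : ℝ), φ (s, 1 - s) := by
  rw [setIntegral_emptyRegion]
  simp_rw [fderiv_comp_reflect_one_zero h]
  rw [integral_fullRegion_fderiv_one_zero (contDiff_comp_reflect h) (hc.comp_homeomorph reflect)]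
  rfl

lemma integral_emptyRegion_fderiv_zero_one (h : ContDiff ℝ 1 φ) (hc : HasCompactSupport φ) :
    ∫ p in emptyRegion, fderiv ℝ φ p (0, 1) =
      -((∫ s in Set.Iio (1 / 2 : ℝ), φ (s, 1 - s)) +
        ∫ s in Set.Ici (1 / 2 : ℝ), φ (s, 1 / 2)) := by
  rw [setIntegral_emptyRegion]
  simp_rw [fderiv_comp_reflect_zero_one h]
  rw [integral_neg, integral_fullRegion_fderiv_zero_one (contDiff_comp_reflect h)
    (hc.comp_homeomorph reflect)]
  simp only [Function.comp_apply, reflect_apply]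
  norm_num

end Regions

/-- The profile is piecewise constant, so any function of it is a combination of indicators. -/
lemma comp_etaFlat (F : ℝ → ℝ) (p : ℝ × ℝ) :
    F (etaFlat p.1 p.2) = F (1 / 2) + fullRegion.indicator (fun _ => F 1 - F (1 / 2)) p
      + emptyRegion.indicator (fun _ => F 0 - F (1 / 2)) p := by
  have hm : min p.1 (1 / 2) ≤ 1 / 2 := min_le_right _ _
  simp only [etaFlat, Set.indicator_apply, fullRegion, emptyRegion, Set.mem_ofPred_eq]
  split_ifs <;> first | ring1 | (exfalso; linarith)

/-- For an entropy pair `(E, Q)`, the entropy production of the profile against a test function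
is concentrated on the two moving shocks and, after they merge, on the stationary shock. -/
lemma integral_entropy_etaFlat {φ : ℝ × ℝ → ℝ} (h : ContDiff ℝ 1 φ) (hc : HasCompactSupport φ)
    (E Q : ℝ → ℝ) :
    Integrable (fun p : ℝ × ℝ => E (etaFlat p.1 p.2) * fderiv ℝ φ p (1, 0)
      + Q (etaFlat p.1 p.2) * fderiv ℝ φ p (0, 1)) ∧
    ∫ p : ℝ × ℝ, (E (etaFlat p.1 p.2) * fderiv ℝ φ p (1, 0)
        + Q (etaFlat p.1 p.2) * fderiv ℝ φ p (0, 1)) =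
      ((Q 1 - Q (1 / 2)) - (E 1 - E (1 / 2))) * (∫ s in Set.Iio (1 / 2 : ℝ), φ (s, s))
      + ((Q (1 / 2) - Q 0) - (E 0 - E (1 / 2))) * (∫ s in Set.Iio (1 / 2 : ℝ), φ (s, 1 - s))
      + (Q 1 - Q 0) * ∫ s in Set.Ici (1 / 2 : ℝ), φ (s, 1 / 2) := by
  have hterm (F : ℝ → ℝ) (v : ℝ × ℝ) :
      Integrable (fun p : ℝ × ℝ => F (etaFlat p.1 p.2) * fderiv ℝ φ p v) ∧
      ∫ p : ℝ × ℝ, F (etaFlat p.1 p.2) * fderiv ℝ φ p v =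
        F (1 / 2) * (∫ p, fderiv ℝ φ p v)
        + (F 1 - F (1 / 2)) * (∫ p in fullRegion, fderiv ℝ φ p v)
        + (F 0 - F (1 / 2)) * ∫ p in emptyRegion, fderiv ℝ φ p v := by
    have hi := integrable_fderiv_apply h hc v
    have h1 := hi.const_mul (F (1 / 2))
    have h2 := (hi.indicator measurableSet_fullRegion).const_mul (F 1 - F (1 / 2))
    have h3 := (hi.indicator measurableSet_emptyRegion).const_mul (F 0 - F (1 / 2))
    have heq : (fun p : ℝ × ℝ => F (etaFlat p.1 p.2) * fderiv ℝ φ p v) = fun p =>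
        F (1 / 2) * fderiv ℝ φ p v
        + (F 1 - F (1 / 2)) * fullRegion.indicator (fun p => fderiv ℝ φ p v) p
        + (F 0 - F (1 / 2)) * emptyRegion.indicator (fun p => fderiv ℝ φ p v) p := by
      ext p
      rw [comp_etaFlat F]
      simp only [Set.indicator]
      split_ifs <;> ring
    rw [heq]
    refine ⟨(h1.add h2).add h3, ?_⟩
    rw [integral_add (by exact h1.add h2) h3, integral_add h1 h2, integral_const_mul,
      integral_const_mul,
      integral_const_mul, integral_indicator measurableSet_fullRegion,
      integral_indicator measurableSet_emptyRegion]
  obtain ⟨hE, hE'⟩ := hterm E (1, 0)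
  obtain ⟨hQ, hQ'⟩ := hterm Q (0, 1)
  refine ⟨hE.add hQ, ?_⟩
  rw [integral_add hE hQ, hE', hQ', integral_fderiv_one_zero h hc, integral_fderiv_zero_one h hc,
    integral_fullRegion_fderiv_one_zero h hc, integral_fullRegion_fderiv_zero_one h hc,
    integral_emptyRegion_fderiv_one_zero h hc, integral_emptyRegion_fderiv_zero_one h hc]
  ring

/-- The iterated integral over the half strip equals the integral over the plane when the
integrand vanishes outside of the half strip. -/
lemma integral_halfStrip_eq {G : ℝ × ℝ → ℝ} (hG : Integrable G)
    (hz : ∀ p ∉ Set.Ioi (0 : ℝ) ×ˢ Set.Ioo (0 : ℝ) 1, G p = 0) :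
    ∫ t in Set.Ioi (0 : ℝ), ∫ x in Set.Ioo (0 : ℝ) 1, G (t, x) = ∫ p, G p := by
  rw [← setIntegral_eq_integral_of_forall_compl_eq_zero hz, Measure.volume_eq_prod,
    setIntegral_prod]
  rw [← Measure.volume_eq_prod]
  exact hG.integrableOn

/-- Rankine–Hugoniot and Lax conditions for the Kruzkov entropies of the three shocks. -/
lemma kruzkov_shock_inequalities {c : ℝ} (hc : c ∈ Set.Icc (0 : ℝ) 1) (Q : ℝ → ℝ)
    (hQ : ∀ u, Q u = -(2 * Real.sign (u - c) * (u * (1 - u) - c * (1 - c)))) :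
    0 ≤ (Q 1 - Q (1 / 2)) - (|1 - c| - |1 / 2 - c|) ∧
    0 ≤ (Q (1 / 2) - Q 0) - (|0 - c| - |1 / 2 - c|) ∧ 0 ≤ Q 1 - Q 0 := by
  obtain ⟨h0, h1⟩ := hc
  have hQ1 : Q 1 = 2 * c * (1 - c) := by
    rw [hQ]
    rcases h1.eq_or_lt with rfl | h
    · simp
    · rw [Real.sign_of_pos (by linarith)]; ring
  have hQ0 : Q 0 = -(2 * c * (1 - c)) := by
    rw [hQ]
    rcases h0.eq_or_lt with rfl | h
    · simp
    · rw [Real.sign_of_neg (by linarith)]; ring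
  have hQh : Q (1 / 2) = -(2 * (1 / 2 - c) * |1 / 2 - c|) := by
    rw [hQ]
    rcases lt_trichotomy (1 / 2 - c) 0 with h | h | h
    · rw [Real.sign_of_neg h, abs_of_neg h]; ring
    · rw [h, Real.sign_zero]; simp
    · rw [Real.sign_of_pos h, abs_of_pos h]; ring
  rw [hQ1, hQ0, hQh, abs_of_nonneg (show 0 ≤ 1 - c by linarith),
    abs_of_nonpos (show 0 - c ≤ 0 by linarith)]
  refine ⟨?_, ?_, by nlinarith⟩ <;>
  · rcases abs_cases (1 / 2 - c) with ⟨h, h'⟩ | ⟨h, h'⟩ <;> rw [h] <;> nlinarith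

lemma measurable_etaFlat (t : ℝ) : Measurable (etaFlat t) :=
  Measurable.ite measurableSet_Iio measurable_const
    (Measurable.ite measurableSet_Ioi measurable_const measurable_const)

lemma abs_etaFlat_sub_half_le (t x : ℝ) : |etaFlat t x - 1 / 2| ≤ 1 := by
  unfold etaFlat
  split_ifs <;> norm_num [abs_le]

/-- The profile attains its flat initial condition in `L¹`. -/
lemma tendsto_integral_abs_etaFlat_sub_half :
    Filter.Tendsto (fun t : ℝ => ∫ x in Set.Ioo (0 : ℝ) 1, |etaFlat t x - 1 / 2|)
      (nhdsWithin 0 (Set.Ioi 0)) (nhds 0) := by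
  have key := tendsto_integral_filter_of_dominated_convergence
    (μ := volume.restrict (Set.Ioo (0 : ℝ) 1)) (l := nhdsWithin (0 : ℝ) (Set.Ioi 0))
    (F := fun t x => |etaFlat t x - 1 / 2|) (f := fun _ => (0 : ℝ)) (fun _ => 1)
    (.of_forall fun t => (((measurable_etaFlat t).sub_const _).norm).aestronglyMeasurable)
    (.of_forall fun t => .of_forall fun x => by
      simpa using abs_etaFlat_sub_half_le t x)
    (integrable_const _) ?_
  · simpa using key
  · refine (ae_restrict_iff' measurableSet_Ioo).2 (.of_forall fun x hx => ?_)
    refine tendsto_const_nhds.congr' ?_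
    filter_upwards [nhdsWithin_le_nhds (Iio_mem_nhds hx.1),
      nhdsWithin_le_nhds (Iio_mem_nhds (sub_pos.2 hx.2))] with t h1 h2
    have h3 : min t (1 / 2) ≤ t := min_le_left _ _
    rw [Set.mem_Iio] at h1 h2
    rw [etaFlat, if_neg (by linarith), if_neg (by linarith)]
    simp

/-- The explicit profile above is a Kruzkov entropy solution of
`∂_t η = 2∂_x(η(1-η))` on `(0,∞)×(0,1)` with initial condition `η(0,·) ≡ 1/2`:
the Kruzkov entropy inequality holds for every constant `c ∈ [0,1]` and every smooth,
compactly supported, nonnegative test function on `(0,∞)×(0,1)`, and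
`∫_0^1 |η(t,x) - 1/2| dx → 0` as `t ↓ 0`. -/
theorem etaFlat_entropy_solution :
    (∀ c ∈ Set.Icc (0 : ℝ) 1, ∀ φ : ℝ × ℝ → ℝ, ContDiff ℝ (⊤ : ℕ∞) φ → HasCompactSupport φ →
      tsupport φ ⊆ Set.Ioi (0 : ℝ) ×ˢ Set.Ioo (0 : ℝ) 1 → (∀ p, 0 ≤ φ p) →
      0 ≤ ∫ t in Set.Ioi (0 : ℝ), ∫ x in Set.Ioo (0 : ℝ) 1,
            (|etaFlat t x - c| * fderiv ℝ φ (t, x) (1, 0)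
              - 2 * Real.sign (etaFlat t x - c) *
                  (etaFlat t x * (1 - etaFlat t x) - c * (1 - c)) *
                  fderiv ℝ φ (t, x) (0, 1))) ∧
    Filter.Tendsto (fun t : ℝ => ∫ x in Set.Ioo (0 : ℝ) 1, |etaFlat t x - 1 / 2|)
      (nhdsWithin 0 (Set.Ioi 0)) (nhds 0) := by
  refine ⟨fun c hc φ hφ hcs hsupp hnn => ?_, tendsto_integral_abs_etaFlat_sub_half⟩
  have hφ1 : ContDiff ℝ 1 φ := hφ.of_le (by exact_mod_cast le_top)
  obtain ⟨Q, hQ⟩ : ∃ Q : ℝ → ℝ,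
      ∀ u, Q u = -(2 * Real.sign (u - c) * (u * (1 - u) - c * (1 - c))) := ⟨_, fun _ => rfl⟩
  obtain ⟨hIntegrable, heq⟩ := integral_entropy_etaFlat hφ1 hcs (fun u => |u - c|) Q
  obtain ⟨hl, hr, hm⟩ := kruzkov_shock_inequalities hc Q hQ
  have hz (v p : ℝ × ℝ) (hp : p ∉ Set.Ioi (0 : ℝ) ×ˢ Set.Ioo (0 : ℝ) 1) :
      fderiv ℝ φ p v = 0 := by
    rw [fderiv_of_notMem_tsupport ℝ fun h => hp (hsupp h)]
    rfl
  have hstrip := integral_halfStrip_eq hIntegrable fun p hp => by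
    rw [hz _ p hp, hz _ p hp, mul_zero, mul_zero, add_zero]
  calc (0 : ℝ) ≤ _ := ?_
    _ = _ := (hstrip.trans heq).symm
    _ = _ := by simp only [hQ, neg_mul, ← sub_eq_add_neg]
  have hnonneg (s : Set ℝ) (m : ℝ → ℝ) : 0 ≤ ∫ t in s, φ (t, m t) :=
    integral_nonneg fun t => hnn _
  exact add_nonneg (add_nonneg (mul_nonneg hl (hnonneg _ fun t => t))
    (mul_nonneg hr (hnonneg _ fun t => 1 - t))) (mul_nonneg hm (hnonneg _ fun _ => 1 / 2))
end

section
/- Approximation of Lipschitz bridges from below: let m₀ : [0,1] → ℝ be 1-Lipschitz with m₀(0) = m₀(1) = 0, and let V(x) := max(-x, x-1). Then for every ε > 0 and δ > 0 there exists a 1-Lipschitz function m⁻ : [0,1] → ℝ with m⁻(0) = m⁻(1) = 0 such that m₀(x) - ε ≤ m⁻(x) ≤ max(m₀(x) - ε/4, V(x)) for all x ∈ [0,1], and ∫_0^1 |(m⁻)'(x) - m₀'(x)| dx ≤ 2ε + δ (the derivatives exist almost everywhere since both functions are Lipschitz). -/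
open MeasureTheory Set in
theorem LipschitzWith.ae_abs_deriv_sub_eq_deriv_of_monotoneOn {u v : ℝ → ℝ} {K L : NNReal}
    {a b : ℝ} (hu : LipschitzWith K u) (hv : LipschitzWith L v)
    (hmono : MonotoneOn (fun x => u x - v x) (Icc a b)) :
    ∀ᵐ x, x ∈ Ioc a b → |deriv u x - deriv v x| = deriv (fun x => u x - v x) x := by
  filter_upwards [hu.ae_differentiableAt_real, hv.ae_differentiableAt_real,
    Measure.ae_ne volume b] with x hux hvx hxb hx
  have hderiv : deriv (fun x => u x - v x) x = deriv u x - deriv v x := deriv_fun_sub hux hvx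
  have hnonneg : 0 ≤ derivWithin (fun x => u x - v x) (Icc a b) x := hmono.derivWithin_nonneg
  rw [derivWithin_of_mem_nhds (Icc_mem_nhds hx.1 (lt_of_le_of_ne hx.2 hxb)), hderiv] at hnonneg
  rw [hderiv, abs_of_nonneg hnonneg]

open MeasureTheory Set in
theorem LipschitzWith.intervalIntegrable_abs_deriv_sub_of_monotoneOn {u v : ℝ → ℝ}
    {K L : NNReal} {a b : ℝ} (hab : a ≤ b) (hu : LipschitzWith K u) (hv : LipschitzWith L v)
    (hmono : MonotoneOn (fun x => u x - v x) (Icc a b)) :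
    IntervalIntegrable (fun x => |deriv u x - deriv v x|) volume a b := by
  have hint := (uIcc_of_le hab ▸ hmono).intervalIntegrable_deriv
  refine hint.congr_ae ?_
  rw [uIoc_of_le hab, Filter.EventuallyEq, ae_restrict_iff' measurableSet_Ioc]
  filter_upwards [hu.ae_abs_deriv_sub_eq_deriv_of_monotoneOn hv hmono] with x hx hxab
  exact (hx hxab).symm

open MeasureTheory Set in
theorem LipschitzWith.integral_abs_deriv_sub_le_of_monotoneOn {u v : ℝ → ℝ}
    {K L : NNReal} {a b : ℝ} (hab : a ≤ b) (hu : LipschitzWith K u) (hv : LipschitzWith L v)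
    (hmono : MonotoneOn (fun x => u x - v x) (Icc a b)) :
    ∫ x in a..b, |deriv u x - deriv v x| ≤ (u b - v b) - (u a - v a) := by
  rw [intervalIntegral.integral_congr_ae (g := deriv (fun x => u x - v x))]
  · have hmem := (uIcc_of_le hab ▸ hmono).intervalIntegral_deriv_mem_uIcc
    have hle : u a - v a ≤ u b - v b :=
      hmono (left_mem_Icc.2 hab) (right_mem_Icc.2 hab) hab
    rw [uIcc_of_le (by linarith)] at hmem
    exact hmem.2
  · rw [uIoc_of_le hab]
    exact hu.ae_abs_deriv_sub_eq_deriv_of_monotoneOn hv hmono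


/-- Approximation of Lipschitz bridges from below: if `m₀` is `1`-Lipschitz with
`m₀(0) = m₀(1) = 0` and `V(x) = max(-x, x-1)`, then for all `ε, δ > 0` there is a
`1`-Lipschitz `m⁻` with `m⁻(0) = m⁻(1) = 0`,
`m₀ - ε ≤ m⁻ ≤ max(m₀ - ε/4, V)` on `[0,1]`, and
`∫_0^1 |(m⁻)' - m₀'| ≤ 2ε + δ`. -/
theorem lipschitz_bridge_approx_below (m₀ : ℝ → ℝ) (hLip : LipschitzWith 1 m₀)
    (h0 : m₀ 0 = 0) (h1 : m₀ 1 = 0) (ε δ : ℝ) (hε : 0 < ε) (hδ : 0 < δ) :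
    ∃ mminus : ℝ → ℝ, LipschitzWith 1 mminus ∧ mminus 0 = 0 ∧ mminus 1 = 0 ∧
      (∀ x ∈ Set.Icc (0 : ℝ) 1,
        m₀ x - ε ≤ mminus x ∧ mminus x ≤ max (m₀ x - ε / 4) (max (-x) (x - 1))) ∧
      ∫ x in (0 : ℝ)..1, |deriv mminus x - deriv m₀ x| ≤ 2 * ε + δ := by
  have habs (x y : ℝ) : |m₀ x - m₀ y| ≤ |x - y| := by
    simpa [Real.dist_eq] using hLip.dist_le_mul x y
  have hgrow {x y : ℝ} (hxy : x ≤ y) : m₀ x - m₀ y ≤ y - x ∧ m₀ y - m₀ x ≤ y - x := by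
    have h := habs x y
    rw [abs_sub_comm x y, abs_of_nonneg (sub_nonneg.2 hxy)] at h
    exact ⟨(abs_le.1 h).2, by linarith [(abs_le.1 h).1]⟩
  set m : ℝ → ℝ := fun x => max (m₀ x - ε) (max (-x) (x - 1)) with hm
  have hmLip : LipschitzWith 1 m := by
    have hshift : LipschitzWith 1 (fun x => m₀ x - ε) :=
      LipschitzWith.of_dist_le_mul fun x y => by simpa using hLip.dist_le_mul x y
    have hneg : LipschitzWith 1 (fun x : ℝ => -x) :=
      LipschitzWith.of_dist_le_mul fun x y => by simp
    have hsub : LipschitzWith 1 (fun x : ℝ => x - 1) :=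
      LipschitzWith.of_dist_le_mul fun x y => by simp
    simpa using hshift.max (hneg.max hsub)
  have hleft {x : ℝ} (hx : x ≤ 1 / 2) : m x = max (m₀ x - ε) (-x) := by
    simp only [hm]
    rw [max_eq_left (a := -x) (by linarith)]
  have hright {x : ℝ} (hx : 1 / 2 ≤ x) : m x = max (m₀ x - ε) (x - 1) := by
    simp only [hm]
    rw [max_eq_right (a := -x) (by linarith)]
  have hm0 : m 0 = 0 := by
    rw [hleft (by norm_num), h0, neg_zero]
    exact max_eq_right (by linarith)
  have hm1 : m 1 = 0 := by
    rw [hright (by norm_num), h1, sub_self]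
    exact max_eq_right (by linarith)
  have hdecr : MonotoneOn (fun x => m₀ x - m x) (Set.Icc 0 (1 / 2)) := by
    intro x hx y hy hxy
    simp only [hleft hx.2, hleft hy.2]
    have := hgrow hxy
    rcases max_cases (m₀ x - ε) (-x) with h | h <;>
      rcases max_cases (m₀ y - ε) (-y) with h' | h' <;> linarith
  have hincr : MonotoneOn (fun x => m x - m₀ x) (Set.Icc (1 / 2) 1) := by
    intro x hx y hy hxy
    simp only [hright hx.1, hright hy.1]
    have := hgrow hxy
    rcases max_cases (m₀ x - ε) (x - 1) with h | h <;>
      rcases max_cases (m₀ y - ε) (y - 1) with h' | h' <;> linarith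
  refine ⟨m, hmLip, hm0, hm1, fun x _ => ⟨le_max_left _ _, ?_⟩, ?_⟩
  · exact max_le_max_right _ (by linarith)
  · have hI₁ := hLip.intervalIntegrable_abs_deriv_sub_of_monotoneOn (by norm_num) hmLip hdecr
    have hB₁ := hLip.integral_abs_deriv_sub_le_of_monotoneOn (by norm_num) hmLip hdecr
    have hI₂ := hmLip.intervalIntegrable_abs_deriv_sub_of_monotoneOn (by norm_num) hLip hincr
    have hB₂ := hmLip.integral_abs_deriv_sub_le_of_monotoneOn (by norm_num) hLip hincr
    simp only [abs_sub_comm (deriv m₀ _)] at hI₁ hB₁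
    rw [← intervalIntegral.integral_add_adjacent_intervals hI₁ hI₂]
    have hmid : m₀ (1 / 2) - ε ≤ m (1 / 2) := le_max_left _ _
    linarith
end
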